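/- Let V₁, V₂ ⊆ V be such that the graph distance between V₁ and V₂ is at least 2, i.e. for all i ∈ V₁ and j ∈ V₂ one has i ≠ j, W_{ij} = 0, and there is no k ∈ V with W_{ik} > 0 and W_{kj} > 0. Then on the probability space (ℝ^V, ν_V^W), the random vectors β ↦ (β_i)_{i∈V₁} and β ↦ (β_j)_{j∈V₂} are independent. -/

import Mathlib

open MeasureTheory Matrix

noncomputable section

/-- The Schrödinger operator `H_β = 2·diag(β) − W`. -/
def Hmat {V : Type*} [Fintype V] [DecidableEq V] (W : Matrix V V ℝ) (β : V → ℝ) :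
    Matrix V V ℝ :=
  2 • Matrix.diagonal β - W

/-- Density of the measure `ν_V^{W,η}` with respect to Lebesgue measure. -/
def nuDens {V : Type*} [Fintype V] [DecidableEq V] (W : Matrix V V ℝ) (η : V → ℝ)
    (β : V → ℝ) : ENNReal :=
  Set.indicator {β : V → ℝ | (Hmat W β).PosDef}
    (fun β => ENNReal.ofReal
      ((2 / Real.pi) ^ ((Fintype.card V : ℝ) / 2) *
        Real.exp (-(1 / 2) * ((1 : V → ℝ) ⬝ᵥ (Hmat W β).mulVec 1
            + η ⬝ᵥ (Hmat W β)⁻¹.mulVec η) + η ⬝ᵥ (1 : V → ℝ)) /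
        Real.sqrt (Hmat W β).det)) β

/-- The measure `ν_V^{W,η}`. -/
def nuMeas {V : Type*} [Fintype V] [DecidableEq V] (W : Matrix V V ℝ) (η : V → ℝ) :
    Measure (V → ℝ) :=
  volume.withDensity (nuDens W η)

/-- The graph on `V` with an edge `{i,j}` whenever `W i j > 0`. -/
def graphOf {V : Type*} (W : Matrix V V ℝ) : SimpleGraph V :=
  SimpleGraph.fromRel (fun i j => 0 < W i j)


universe u

lemma gauss_univ : ∫⁻ u : ℝ, ENNReal.ofReal (Real.exp (-u^2/2)) = ENNReal.ofReal (√(2*Real.pi)) := by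
  have h := integral_gaussian (1/2 : ℝ)
  have hi := integrable_exp_neg_mul_sq (b := (1/2:ℝ)) (by norm_num)
  rw [show (2 * Real.pi) = Real.pi / (1/2) by ring, ← h,
    ofReal_integral_eq_lintegral_ofReal hi (Filter.Eventually.of_forall fun x => (Real.exp_pos _).le)]
  refine lintegral_congr fun u => ?_
  congr 2; ring

lemma gauss_Ioi : ∫⁻ u in Set.Ioi (0:ℝ), ENNReal.ofReal (Real.exp (-u^2/2))
    = ENNReal.ofReal (√(2*Real.pi) / 2) := by
  have h := integral_gaussian_Ioi (1/2 : ℝ)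
  have hi := (integrable_exp_neg_mul_sq (b := (1/2:ℝ)) (by norm_num)).integrableOn (s := Set.Ioi 0)
  rw [show (2 * Real.pi) = Real.pi / (1/2) by ring, ← h,
    ofReal_integral_eq_lintegral_ofReal hi (Filter.Eventually.of_forall fun x => (Real.exp_pos _).le)]
  refine lintegral_congr fun u => ?_
  congr 2; ring

lemma phi_deriv (a : ℝ) {s : ℝ} (hs : 0 < s) :
    HasDerivAt (fun s : ℝ => √s - a / √s) ((1/2) * (1 / √s + a / (s * √s))) s := by
  have h1 := Real.hasDerivAt_sqrt hs.ne'
  have hq : √s ≠ 0 := (Real.sqrt_pos.2 hs).ne'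
  have h2 := (h1.inv hq).const_mul a
  have h3 := h1.sub h2
  convert! h3 using 1
  have : √s ^ 2 = s := Real.sq_sqrt hs.le
  rw [this]
  field_simp
  ring

lemma phi_inj {a : ℝ} (ha : 0 ≤ a) : Set.InjOn (fun s : ℝ => √s - a / √s) (Set.Ioi 0) := by
  apply StrictMonoOn.injOn
  intro s hs t ht hst
  have h0 : 0 < √s := Real.sqrt_pos.2 hs
  have h1 : √s < √t := Real.sqrt_lt_sqrt (le_of_lt hs) hst
  have h2 : a / √t ≤ a / √s := by gcongr
  show √s - a / √s < √t - a / √t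
  linarith

lemma phi_image {a : ℝ} (ha : 0 < a) : (fun s : ℝ => √s - a / √s) '' (Set.Ioi 0) = Set.univ := by
  refine Set.eq_univ_of_forall fun u => ?_
  have h0 : 0 ≤ u^2 + 4*a := by positivity
  have h1 : √(u^2+4*a)^2 = u^2 + 4*a := Real.sq_sqrt h0
  have h2 : |u| < √(u^2+4*a) := by
    rw [← Real.sqrt_sq_eq_abs]; exact Real.sqrt_lt_sqrt (sq_nonneg u) (by linarith)
  have h3 : 0 < (u + √(u^2+4*a))/2 := by
    have := neg_abs_le u; linarith
  refine ⟨((u + √(u^2+4*a))/2)^2, by simp only [Set.mem_Ioi]; positivity, ?_⟩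
  show √_ - a / √_ = u
  rw [Real.sqrt_sq h3.le, sub_eq_iff_eq_add]
  rw [← sub_eq_iff_eq_add', eq_div_iff h3.ne']
  nlinarith

lemma phi_image_zero : (fun s : ℝ => √s - 0 / √s) '' (Set.Ioi 0) = Set.Ioi 0 := by
  ext u
  constructor
  · rintro ⟨s, hs, rfl⟩
    simpa using hs
  · intro hu
    refine ⟨u^2, by have : 0 < u := hu; simp only [Set.mem_Ioi]; positivity, ?_⟩
    simp [Real.sqrt_sq (le_of_lt hu)]

lemma scalar_cov {a : ℝ} (ha : 0 ≤ a) :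
    ∫⁻ u in (fun s : ℝ => √s - a / √s) '' (Set.Ioi 0), ENNReal.ofReal (Real.exp (-u^2/2))
    = ∫⁻ s in Set.Ioi (0:ℝ), (ENNReal.ofReal (Real.exp a / 2) *
        (ENNReal.ofReal (Real.exp (-(s + a^2/s)/2) / √s) +
         ENNReal.ofReal (Real.exp (-(s + a^2/s)/2) * (a / (s * √s))))) := by
  rw [lintegral_image_eq_lintegral_abs_deriv_mul measurableSet_Ioi
    (fun s hs => (phi_deriv a hs).hasDerivWithinAt) (phi_inj ha)]
  refine setLIntegral_congr_fun measurableSet_Ioi fun s hs => ?_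
  have hs : 0 < s := hs
  have hq : 0 < √s := Real.sqrt_pos.2 hs
  have hsq : √s ^ 2 = s := Real.sq_sqrt hs.le
  rw [← ENNReal.ofReal_add (by positivity) (by positivity), ← ENNReal.ofReal_mul (by positivity),
    ← ENNReal.ofReal_mul (by positivity)]
  congr 1
  rw [abs_of_nonneg (by positivity)]
  have : -(√s - a / √s)^2/2 = a + -(s + a^2/s)/2 := by
    have : (√s - a / √s)^2 = √s^2 + a^2/√s^2 - 2 * a := by field_simp; ring
    rw [this, hsq]; ring
  rw [this, Real.exp_add]
  ring

lemma scalar_inv {a : ℝ} (ha : 0 < a) :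
    ∫⁻ s in Set.Ioi (0:ℝ), ENNReal.ofReal (Real.exp (-(s + a^2/s)/2) / √s)
    = ∫⁻ s in Set.Ioi (0:ℝ), ENNReal.ofReal (Real.exp (-(s + a^2/s)/2) * (a / (s * √s))) := by
  have him : (fun s : ℝ => a^2 / s) '' (Set.Ioi 0) = Set.Ioi 0 := by
    ext u
    constructor
    · rintro ⟨s, hs, rfl⟩
      have hs : 0 < s := hs
      simp only [Set.mem_Ioi]; positivity
    · intro hu
      have hu : 0 < u := hu
      refine ⟨a^2/u, by simp only [Set.mem_Ioi]; positivity, ?_⟩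
      field_simp
  have hder : ∀ s ∈ Set.Ioi (0:ℝ), HasDerivWithinAt (fun s : ℝ => a^2 / s) (a^2 * (-(s^2)⁻¹)) (Set.Ioi 0) s := by
    intro s hs
    have hs : 0 < s := hs
    exact ((hasDerivAt_inv hs.ne').const_mul (a^2)).hasDerivWithinAt
  have hinj : Set.InjOn (fun s : ℝ => a^2 / s) (Set.Ioi 0) := by
    intro s hs t ht h
    have hs : 0 < s := hs
    have ht : 0 < t := ht
    have h : a^2 / s = a^2 / t := h
    field_simp at h
    exact h.symm
  conv_lhs => rw [← him]
  rw [lintegral_image_eq_lintegral_abs_deriv_mul measurableSet_Ioi hder hinj]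
  refine setLIntegral_congr_fun measurableSet_Ioi fun s hs => ?_
  have hs : 0 < s := hs
  have hq : 0 < √s := Real.sqrt_pos.2 hs
  have hsq : √s ^ 2 = s := Real.sq_sqrt hs.le
  rw [← ENNReal.ofReal_mul (by positivity)]
  congr 1
  rw [mul_neg, abs_neg, abs_of_nonneg (by positivity), Real.sqrt_div (by positivity), Real.sqrt_sq ha.le]
  have : a^2/s + a^2/(a^2/s) = s + a^2/s := by field_simp; ring
  rw [this]
  field_simp
  rw [hsq]

lemma scalar_int {a : ℝ} (ha : 0 ≤ a) :
    ∫⁻ s in Set.Ioi (0:ℝ), ENNReal.ofReal (Real.exp (-(s + a^2/s)/2) / √s)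
    = ENNReal.ofReal (√(2*Real.pi) * Real.exp (-a)) := by
  have hc := scalar_cov ha
  have hm1 : Measurable fun s : ℝ => ENNReal.ofReal (Real.exp (-(s + a^2/s)/2) / √s) := by fun_prop
  have hm2 : Measurable fun s : ℝ => ENNReal.ofReal (Real.exp (-(s + a^2/s)/2) * (a / (s * √s))) := by
    fun_prop
  rw [lintegral_const_mul _ (by fun_prop), lintegral_add_left hm1] at hc
  set I := ∫⁻ s in Set.Ioi (0:ℝ), ENNReal.ofReal (Real.exp (-(s + a^2/s)/2) / √s) with hI
  have key : ENNReal.ofReal (Real.exp a) * I = ENNReal.ofReal (√(2*Real.pi)) := by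
    rcases ha.eq_or_lt with h | h
    · subst h
      rw [phi_image_zero, gauss_Ioi] at hc
      simp only [zero_div, mul_zero, ENNReal.ofReal_zero, lintegral_zero, add_zero, Real.exp_zero] at hc
      rw [Real.exp_zero, ENNReal.ofReal_one, one_mul]
      have h2 : ENNReal.ofReal 2 * ENNReal.ofReal (√(2 * Real.pi) / 2) = ENNReal.ofReal 2 * (ENNReal.ofReal (1/2) * I) := by
        rw [hc]
      rw [← mul_assoc, ← ENNReal.ofReal_mul (by norm_num), ← ENNReal.ofReal_mul (by norm_num)] at h2
      rw [show (2:ℝ) * (1/2) = 1 by norm_num, ENNReal.ofReal_one, one_mul] at h2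
      rw [← h2]; congr 1; ring
    · rw [phi_image h, ← scalar_inv h, ← hI, Measure.restrict_univ, gauss_univ] at hc
      rw [hc, ← two_mul, ← mul_assoc]
      congr 1
      rw [show (2:ENNReal) = ENNReal.ofReal 2 by simp, ← ENNReal.ofReal_mul (by positivity)]
      congr 1; ring
  have : I = ENNReal.ofReal (Real.exp (-a)) * (ENNReal.ofReal (Real.exp a) * I) := by
    rw [← mul_assoc, ← ENNReal.ofReal_mul (Real.exp_pos _).le, ← Real.exp_add]; simp
  rw [this, key, ← ENNReal.ofReal_mul (Real.exp_pos _).le, mul_comm]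

lemma scalar_shift {a : ℝ} (ha : 0 ≤ a) (k : ℝ) :
    ∫⁻ x : ℝ, Set.indicator (Set.Ioi (0:ℝ))
      (fun s => ENNReal.ofReal (Real.exp (-(s + a^2/s)/2) / √s)) (2 * x - k)
    = ENNReal.ofReal (√(Real.pi / 2) * Real.exp (-a)) := by
  set g := Set.indicator (Set.Ioi (0:ℝ))
      (fun s => ENNReal.ofReal (Real.exp (-(s + a^2/s)/2) / √s)) with hg
  have hgm : Measurable g := by
    refine Measurable.indicator ?_ measurableSet_Ioi
    fun_prop
  have h1 : ∫⁻ x : ℝ, g (2 * x - k) = ∫⁻ y, g (y - k) ∂(Measure.map (fun x : ℝ => 2 * x) volume) := by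
    rw [lintegral_map (by fun_prop) (by fun_prop)]
  rw [h1, Real.map_volume_mul_left (by norm_num), lintegral_smul_measure, lintegral_sub_right_eq_self g k,
    hg, lintegral_indicator measurableSet_Ioi, scalar_int ha, smul_eq_mul,
    ← ENNReal.ofReal_mul (by positivity)]
  congr 1
  rw [show 2 * Real.pi = (Real.pi/2) * 2^2 by ring, Real.sqrt_mul (by positivity), Real.sqrt_sq (by norm_num)]
  rw [abs_of_pos (by norm_num)]
  ring
section mats
variable {m n : Type*} [Fintype m] [Fintype n] [DecidableEq m] [DecidableEq n]

lemma posDef_iff_semidef_det {M : Matrix n n ℝ} : M.PosDef ↔ M.PosSemidef ∧ M.det ≠ 0 := by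
  constructor
  · intro h; exact ⟨h.posSemidef, h.det_pos.ne'⟩
  · rintro ⟨h, hd⟩
    exact h.posDef_iff_isUnit.2 ((Matrix.isUnit_iff_isUnit_det _).2 hd.isUnit)

lemma det_schur (A : Matrix m m ℝ) (B : Matrix m n ℝ) {D : Matrix n n ℝ} (hD : D.PosDef) :
    (fromBlocks A B Bᵀ D).det = D.det * (A - B * D⁻¹ * Bᵀ).det := by
  have : Invertible D := hD.isUnit.invertible
  rw [det_fromBlocks₂₂, invOf_eq_nonsing_inv]

lemma posDef_schur (A : Matrix m m ℝ) (B : Matrix m n ℝ) {D : Matrix n n ℝ} (hD : D.PosDef) :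
    (fromBlocks A B Bᵀ D).PosDef ↔ (A - B * D⁻¹ * Bᵀ).PosDef := by
  have : Invertible D := hD.isUnit.invertible
  have h := Matrix.PosDef.fromBlocks₂₂ A B hD
  rw [conjTranspose_eq_transpose_of_trivial] at h
  rw [posDef_iff_semidef_det, posDef_iff_semidef_det, h, det_schur A B hD]
  simp [hD.det_pos.ne']

lemma posDef_block₂₂ {A : Matrix m m ℝ} {B : Matrix m n ℝ} {D : Matrix n n ℝ} 
    (h : (fromBlocks A B Bᵀ D).PosDef) : D.PosDef :=
  h.submatrix (e := Sum.inr) Sum.inr_injective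

lemma quad_inv_schur (A : Matrix m m ℝ) (B : Matrix m n ℝ) {D : Matrix n n ℝ} (hD : D.PosDef)
    (hS : (A - B * D⁻¹ * Bᵀ).PosDef) (x : m → ℝ) (y : n → ℝ) :
    Sum.elim x y ⬝ᵥ (fromBlocks A B Bᵀ D)⁻¹ *ᵥ Sum.elim x y
      = y ⬝ᵥ D⁻¹ *ᵥ y + (x - B *ᵥ (D⁻¹ *ᵥ y)) ⬝ᵥ (A - B * D⁻¹ * Bᵀ)⁻¹ *ᵥ (x - B *ᵥ (D⁻¹ *ᵥ y)) := by
  set S := A - B * D⁻¹ * Bᵀ with hSdef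
  set r := x - B *ᵥ (D⁻¹ *ᵥ y) with hr
  have hM : (fromBlocks A B Bᵀ D).PosDef := (posDef_schur A B hD).2 hS
  set p := S⁻¹ *ᵥ r with hp
  have hDu : IsUnit D.det := hD.det_pos.ne'.isUnit
  have hSu : IsUnit S.det := hS.det_pos.ne'.isUnit
  have hDD : ∀ v, D *ᵥ (D⁻¹ *ᵥ v) = v := fun v => by
    rw [mulVec_mulVec, mul_nonsing_inv _ hDu, one_mulVec]
  have hSp : S *ᵥ p = r := by
    rw [hp, mulVec_mulVec, mul_nonsing_inv _ hSu, one_mulVec]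
  have hA : A *ᵥ p = r + B *ᵥ (D⁻¹ *ᵥ (Bᵀ *ᵥ p)) := by
    rw [← hSp, hSdef, sub_mulVec]; simp [mulVec_mulVec, Matrix.mul_assoc]
  set q := D⁻¹ *ᵥ y - D⁻¹ *ᵥ (Bᵀ *ᵥ p) with hq
  have hz : fromBlocks A B Bᵀ D *ᵥ Sum.elim p q = Sum.elim x y := by
    rw [fromBlocks_mulVec]
    simp only [Sum.elim_comp_inl, Sum.elim_comp_inr]
    congr 1
    · rw [hA, hq, mulVec_sub, hr]; abel
    · rw [hq, mulVec_sub, hDD, hDD]; abel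
  have hz' : (fromBlocks A B Bᵀ D)⁻¹ *ᵥ Sum.elim x y = Sum.elim p q := by
    rw [← hz, mulVec_mulVec, nonsing_inv_mul _ hM.det_pos.ne'.isUnit, one_mulVec]
  rw [hz', sumElim_dotProduct_sumElim, hq, dotProduct_sub, hr, sub_dotProduct]
  have hDt : D⁻¹ᵀ = D⁻¹ := by
    have := hD.inv.isHermitian
    rwa [IsHermitian, conjTranspose_eq_transpose_of_trivial] at this
  have : y ⬝ᵥ D⁻¹ *ᵥ (Bᵀ *ᵥ p) = (B *ᵥ (D⁻¹ *ᵥ y)) ⬝ᵥ p := by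
    rw [dotProduct_mulVec, ← mulVec_transpose, hDt, dotProduct_mulVec, vecMul_transpose]
  rw [this]; ring

/-- inverse positivity -/
lemma inv_nonneg_of_Z {D : Matrix n n ℝ} (hD : D.PosDef) (hZ : ∀ i j, i ≠ j → D i j ≤ 0)
    {x : n → ℝ} (hx : ∀ i, 0 ≤ x i) : ∀ i, 0 ≤ (D⁻¹ *ᵥ x) i := by
  set y := D⁻¹ *ᵥ x with hy
  have hDy : D *ᵥ y = x := by
    rw [hy, mulVec_mulVec, mul_nonsing_inv _ hD.det_pos.ne'.isUnit, one_mulVec]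
  set z : n → ℝ := fun i => max (- y i) 0 with hz
  have hz0 : ∀ i, 0 ≤ z i := fun i => le_max_right _ _
  have h1 : 0 ≤ z ⬝ᵥ D *ᵥ y := by
    rw [hDy]; exact Finset.sum_nonneg fun i _ => mul_nonneg (hz0 i) (hx i)
  have h2 : z ⬝ᵥ D *ᵥ (y + z) ≤ 0 := by
    refine Finset.sum_nonpos fun i _ => ?_
    simp only [mulVec, dotProduct, Finset.mul_sum]
    refine Finset.sum_nonpos fun j _ => ?_
    have hp : 0 ≤ (y + z) j := by
      simp only [Pi.add_apply, hz]; have := le_max_left (- y j) 0; linarith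
    by_cases hij : i = j
    · subst hij
      have : z i * (y + z) i = 0 := by
        simp only [Pi.add_apply, hz]
        rcases le_total (- y i) 0 with h | h
        · simp [max_eq_right h]
        · simp [max_eq_left h]
      have h3 : z i * (D i i * (y + z) i) = D i i * (z i * (y + z) i) := by ring
      rw [h3, this, mul_zero]
    · exact mul_nonpos_of_nonneg_of_nonpos (hz0 i) (mul_nonpos_of_nonpos_of_nonneg (hZ i j hij) hp)
  rw [mulVec_add, dotProduct_add] at h2
  have h3 : z = 0 := by
    by_contra hne
    have := hD.dotProduct_mulVec_pos hne
    simp only [star_trivial] at this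
    linarith
  intro i
  have : z i = 0 := congrFun h3 i
  have h4 := le_max_left (- y i) 0
  simp only [hz] at this
  linarith

lemma Hmat_apply (W : Matrix n n ℝ) (β : n → ℝ) (i j : n) :
    Hmat W β i j = 2 * (if i = j then β i else 0) - W i j := by
  unfold Hmat
  rw [Matrix.sub_apply, Matrix.smul_apply, diagonal_apply]
  simp

lemma Hmat_symm {W : Matrix n n ℝ} (hW : W.IsSymm) (β : n → ℝ) : (Hmat W β).IsSymm := by
  ext i j
  rw [transpose_apply, Hmat_apply, Hmat_apply, hW.apply]
  by_cases h : i = j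
  · subst h; rfl
  · simp [h, Ne.symm h]

open Classical in
lemma nuDens_eq (W : Matrix n n ℝ) (η β : n → ℝ) : nuDens W η β = 
    if (Hmat W β).PosDef then ENNReal.ofReal
      ((2 / Real.pi) ^ ((Fintype.card n : ℝ) / 2) *
        Real.exp (-(1 / 2) * ((1 : n → ℝ) ⬝ᵥ (Hmat W β).mulVec 1
            + η ⬝ᵥ (Hmat W β)⁻¹.mulVec η) + η ⬝ᵥ (1 : n → ℝ)) /
        Real.sqrt (Hmat W β).det) else 0 := by
  unfold nuDens
  rw [Set.indicator_apply]
  rfl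

lemma Hmat_sum {W : Matrix (m ⊕ n) (m ⊕ n) ℝ} (hW : W.IsSymm) (b : m → ℝ) (c : n → ℝ) :
    Hmat W (Sum.elim b c) = fromBlocks (Hmat W.toBlocks₁₁ b) (-W.toBlocks₁₂)
      (-W.toBlocks₁₂)ᵀ (Hmat W.toBlocks₂₂ c) := by
  ext (i | i) (j | j)
  · simp [Hmat_apply, toBlocks₁₁]
  · simp [Hmat_apply, toBlocks₁₂]
  · simp [Hmat_apply, toBlocks₁₂, hW.apply]
  · simp [Hmat_apply, toBlocks₂₂]

lemma quad_one_sum (A : Matrix m m ℝ) (B : Matrix m n ℝ) (D : Matrix n n ℝ) :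
    (1 : m ⊕ n → ℝ) ⬝ᵥ (fromBlocks A B Bᵀ D) *ᵥ 1 = 
      (1 : m → ℝ) ⬝ᵥ A *ᵥ 1 + 2 * ((1 : m → ℝ) ⬝ᵥ B *ᵥ 1) + (1 : n → ℝ) ⬝ᵥ D *ᵥ 1 := by
  have h1 : (1 : m ⊕ n → ℝ) = Sum.elim (1 : m → ℝ) (1 : n → ℝ) := by ext (i | i) <;> rfl
  rw [h1, fromBlocks_mulVec, sumElim_dotProduct_sumElim]
  simp only [Sum.elim_comp_inl, Sum.elim_comp_inr, dotProduct_add]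
  have : (1 : n → ℝ) ⬝ᵥ Bᵀ *ᵥ (1 : m → ℝ) = (1 : m → ℝ) ⬝ᵥ B *ᵥ 1 := by
    rw [mulVec_transpose, dotProduct_comm, dotProduct_mulVec]
  rw [this]; ring

lemma nuDens_reindex (e : m ≃ n) (W : Matrix n n ℝ) (η β : n → ℝ) :
    nuDens (W.submatrix e e) (η ∘ e) (β ∘ e) = nuDens W η β := by
  have hH : Hmat (W.submatrix e e) (β ∘ e) = (Hmat W β).submatrix e e := by
    ext i j; simp [Hmat_apply]
  have h1 : (1 : m → ℝ) = (1 : n → ℝ) ∘ e := rfl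
  have hpd : ((Hmat W β).submatrix e e).PosDef ↔ (Hmat W β).PosDef := by
    constructor
    · intro h
      have := h.submatrix e.symm.injective
      simpa using this
    · intro h; exact h.submatrix e.injective
  have hpd' : (Hmat (W.submatrix e e) (β ∘ e)).PosDef ↔ (Hmat W β).PosDef := by rw [hH, hpd]
  rw [nuDens_eq, nuDens_eq]
  by_cases hp : (Hmat W β).PosDef
  swap
  · rw [if_neg hp, if_neg (fun h => hp (hpd'.1 h))]
  rw [if_pos hp, if_pos (hpd'.2 hp)]
  simp only [hH, inv_submatrix_equiv,
    det_submatrix_equiv_self, Fintype.card_congr e]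
  rw [h1]
  simp only [submatrix_mulVec_equiv, Function.comp_assoc, Equiv.self_comp_symm, Function.comp_id,
    comp_equiv_dotProduct_comp_equiv]

lemma nuDens_measurable (W : Matrix n n ℝ) (hW : W.IsSymm) (η : n → ℝ) :
    Measurable (nuDens W η) := by
  have hc : Continuous (fun β : n → ℝ => Hmat W β) := by
    unfold Hmat; fun_prop
  have hent : ∀ i j, Measurable (fun β : n → ℝ => Hmat W β i j) := fun i j =>
    (hc.matrix_elem i j).measurable
  have hdet : Continuous (fun β : n → ℝ => (Hmat W β).det) := hc.matrix_det
  have hinv : ∀ i j, Measurable (fun β : n → ℝ => (Hmat W β)⁻¹ i j) := by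
    intro i j
    simp only [inv_def, Ring.inverse_eq_inv', Matrix.smul_apply, smul_eq_mul]
    exact hdet.measurable.inv.mul ((hc.matrix_adjugate.matrix_elem i j).measurable)
  have hset : MeasurableSet {β : n → ℝ | (Hmat W β).PosDef} := by
    have : {β : n → ℝ | (Hmat W β).PosDef} = 
        (⋂ x : n → ℝ, {β : n → ℝ | 0 ≤ x ⬝ᵥ (Hmat W β) *ᵥ x}) ∩ {β | (Hmat W β).det ≠ 0} := by
      ext β
      have hh : (Hmat W β).IsHermitian := by
        rw [IsHermitian, conjTranspose_eq_transpose_of_trivial]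
        exact Hmat_symm hW β
      rw [Set.mem_inter_iff, Set.mem_iInter]
      change (Hmat W β).PosDef ↔ (∀ x, 0 ≤ x ⬝ᵥ (Hmat W β) *ᵥ x) ∧ (Hmat W β).det ≠ 0
      rw [posDef_iff_semidef_det, posSemidef_iff_dotProduct_mulVec, and_iff_right hh]
      simp only [star_trivial]
    rw [this]
    refine MeasurableSet.inter ?_ ?_
    · refine (isClosed_iInter fun x => isClosed_le continuous_const ?_).measurableSet
      fun_prop
    · exact (isOpen_ne_fun hdet continuous_const).measurableSet
  unfold nuDens
  refine Measurable.indicator ?_ hset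
  refine ENNReal.measurable_ofReal.comp ?_
  have hd := hdet.measurable
  have hq1 : Measurable fun β : n → ℝ => (1 : n → ℝ) ⬝ᵥ (Hmat W β).mulVec 1 := by
    refine Finset.measurable_sum _ fun i _ => Measurable.const_mul ?_ _
    exact Finset.measurable_sum _ fun j _ => (hent i j).mul_const _
  have hq2 : Measurable fun β : n → ℝ => η ⬝ᵥ (Hmat W β)⁻¹.mulVec η := by
    refine Finset.measurable_sum _ fun i _ => Measurable.const_mul ?_ _
    exact Finset.measurable_sum _ fun j _ => (hinv i j).mul_const _
  exact ((((hq1.add hq2).const_mul _).add_const _).exp.const_mul _).div hd.sqrt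

end mats
section dens
variable {m n : Type*} [Fintype m] [Fintype n] [DecidableEq m] [DecidableEq n]

lemma rpow_card_add : (2 / Real.pi) ^ ((Fintype.card (m ⊕ n) : ℝ) / 2) =
    (2 / Real.pi) ^ ((Fintype.card m : ℝ) / 2) * (2 / Real.pi) ^ ((Fintype.card n : ℝ) / 2) := by
  rw [← Real.rpow_add (by positivity), Fintype.card_sum]
  congr 1; push_cast; ring

lemma nuDens_prod {W : Matrix (m ⊕ n) (m ⊕ n) ℝ} (hW : W.IsSymm) (h0 : W.toBlocks₁₂ = 0)
    (η : m ⊕ n → ℝ) (b : m → ℝ) (c : n → ℝ) :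
    nuDens W η (Sum.elim b c) =
      nuDens W.toBlocks₁₁ (η ∘ Sum.inl) b * nuDens W.toBlocks₂₂ (η ∘ Sum.inr) c := by
  have hH := Hmat_sum hW b c
  have hη : η = Sum.elim (η ∘ Sum.inl) (η ∘ Sum.inr) := (Sum.elim_comp_inl_inr η).symm
  set x := η ∘ Sum.inl with hx
  set y := η ∘ Sum.inr with hy
  set A := Hmat W.toBlocks₁₁ b with hA
  set D := Hmat W.toBlocks₂₂ c with hD
  rw [nuDens_eq, nuDens_eq, nuDens_eq, ← hA, ← hD]
  by_cases hDp : D.PosDef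
  swap
  · rw [if_neg hDp, mul_zero, if_neg]
    intro h; rw [hH] at h; exact hDp (posDef_block₂₂ h)
  have hS : A - (-W.toBlocks₁₂) * D⁻¹ * (-W.toBlocks₁₂)ᵀ = A := by simp [h0]
  have hiff := posDef_schur A (-W.toBlocks₁₂) hDp
  rw [hS, ← hH] at hiff
  by_cases hAp : A.PosDef
  swap
  · rw [if_neg hAp, zero_mul, if_neg (fun h => hAp (hiff.1 h))]
  rw [if_pos hDp, if_pos hAp, if_pos (hiff.2 hAp), ← ENNReal.ofReal_mul (by positivity)]
  congr 1
  have hdet := det_schur A (-W.toBlocks₁₂) hDp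
  have hq := quad_inv_schur A (-W.toBlocks₁₂) hDp (by rw [hS]; exact hAp) x y
  have ho := quad_one_sum A (-W.toBlocks₁₂) D
  rw [hS] at hdet hq
  rw [← hH] at hdet hq ho
  rw [← hη] at hq
  have hηo : η ⬝ᵥ (1 : m ⊕ n → ℝ) = x ⬝ᵥ 1 + y ⬝ᵥ 1 := by
    simp [dotProduct, hx, hy]
  rw [hdet, hq, ho, hηo, rpow_card_add, Real.sqrt_mul hDp.det_pos.le]
  simp only [h0, neg_zero, zero_mulVec, sub_zero, dotProduct_zero, mul_zero, add_zero]
  rw [show -(1/2) * (1 ⬝ᵥ A *ᵥ 1 + 1 ⬝ᵥ D *ᵥ 1 + (y ⬝ᵥ D⁻¹ *ᵥ y + x ⬝ᵥ A⁻¹ *ᵥ x)) + (x ⬝ᵥ 1 + y ⬝ᵥ 1)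
    = (-(1/2) * (1 ⬝ᵥ A *ᵥ 1 + x ⬝ᵥ A⁻¹ *ᵥ x) + x ⬝ᵥ 1) +
      (-(1/2) * (1 ⬝ᵥ D *ᵥ 1 + y ⬝ᵥ D⁻¹ *ᵥ y) + y ⬝ᵥ 1) by ring, Real.exp_add]
  have := Real.sqrt_pos.2 hDp.det_pos
  have := Real.sqrt_pos.2 hAp.det_pos
  field_simp

lemma unique_eq_diag [Unique m] (S : Matrix m m ℝ) : S = diagonal (fun _ => S default default) := by
  ext i j
  rw [Unique.eq_default i, Unique.eq_default j]; simp

lemma posDef_unique [Unique m] (S : Matrix m m ℝ) : S.PosDef ↔ 0 < S default default := by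
  rw [unique_eq_diag S, posDef_diagonal_iff]
  simp

lemma quad_inv_unique [Unique m] (S : Matrix m m ℝ) (hS : 0 < S default default) (r : m → ℝ) :
    r ⬝ᵥ S⁻¹ *ᵥ r = r default ^ 2 / S default default := by
  have h1 : S⁻¹ = diagonal (fun _ => (S default default)⁻¹) := by
    apply inv_eq_right_inv
    ext i j
    rw [Unique.eq_default i, Unique.eq_default j]
    simp [mul_apply, hS.ne']
  rw [h1]
  simp [dotProduct, mulVec_diagonal]
  ring

lemma nuDens_marg [Unique m] {W : Matrix (m ⊕ n) (m ⊕ n) ℝ} (hW : W.IsSymm)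
    (hnn : ∀ i j, 0 ≤ W i j) (hdiag : ∀ i, W i i = 0)
    (η : m ⊕ n → ℝ) (hη0 : ∀ i, 0 ≤ η i) (c : n → ℝ) :
    ∫⁻ x : ℝ, nuDens W η (Sum.elim (fun _ => x) c) =
      nuDens W.toBlocks₂₂ (fun j => η (Sum.inr j) + W (Sum.inl default) (Sum.inr j)) c := by
  have hη : η = Sum.elim (η ∘ Sum.inl) (η ∘ Sum.inr) := (Sum.elim_comp_inl_inr η).symm
  set z := η ∘ Sum.inl with hz
  set y := η ∘ Sum.inr with hy
  set w : n → ℝ := fun j => W (Sum.inl default) (Sum.inr j) with hw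
  set D := Hmat W.toBlocks₂₂ c with hD
  set B := -W.toBlocks₁₂ with hB
  have hH : ∀ x : ℝ, Hmat W (Sum.elim (fun _ => x) c) =
      fromBlocks (Hmat W.toBlocks₁₁ (fun _ => x)) B Bᵀ D := fun x => Hmat_sum hW _ c
  have hv : (fun j => η (Sum.inr j) + W (Sum.inl default) (Sum.inr j)) = y + w := rfl
  rw [hv]
  by_cases hDp : D.PosDef
  swap
  · rw [nuDens_eq, if_neg hDp]
    simp only [lintegral_eq_zero_iff', nuDens_eq]
    rw [lintegral_congr (g := fun _ => 0), lintegral_zero]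
    intro x
    rw [if_neg]
    intro h; rw [hH] at h; exact hDp (posDef_block₂₂ h)
  have hBv : ∀ v : n → ℝ, (B *ᵥ v) default = - (w ⬝ᵥ v) := by
    intro v; rw [hB, neg_mulVec]; rfl
  set k := w ⬝ᵥ D⁻¹ *ᵥ w with hk
  set a := z default + w ⬝ᵥ D⁻¹ *ᵥ y with ha
  have hw0 : ∀ j, 0 ≤ w j := fun j => hnn _ _
  have ha0 : 0 ≤ a := by
    refine add_nonneg (hη0 _) (Finset.sum_nonneg fun j _ => mul_nonneg (hw0 j) ?_)
    refine inv_nonneg_of_Z hDp ?_ (fun i => hη0 _) j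
    intro i j hij
    rw [hD, Hmat_apply, if_neg hij]
    have : 0 ≤ W.toBlocks₂₂ i j := hnn _ _
    linarith
  have hSk : ∀ x : ℝ, (Hmat W.toBlocks₁₁ (fun _ : m => x) - B * D⁻¹ * Bᵀ) default default = 2 * x - k := by
    intro x
    have h1 : (B * D⁻¹ * Bᵀ) default default = k := by
      have : (B * D⁻¹ * Bᵀ) default default = (B *ᵥ (D⁻¹ *ᵥ (B default))) default := by
        rw [mulVec_mulVec]; rfl
      rw [this, hBv]
      have : B default = - w := by ext j; rfl
      rw [this, mulVec_neg, dotProduct_neg, neg_neg]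
    have h2 : W.toBlocks₁₁ (default : m) default = 0 := hdiag _
    rw [Matrix.sub_apply, h1, Hmat_apply, h2]; simp
  have hηo : η ⬝ᵥ (1 : m ⊕ n → ℝ) = z default + y ⬝ᵥ 1 := by
    simp [dotProduct, hz, hy]
  have hB1 : (1 : m → ℝ) ⬝ᵥ B *ᵥ 1 = - (w ⬝ᵥ 1) := by
    rw [← hBv]; simp [dotProduct]
  have hA1 : ∀ x : ℝ, (1 : m → ℝ) ⬝ᵥ (Hmat W.toBlocks₁₁ (fun _ : m => x)) *ᵥ 1 = 2 * x := by
    intro x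
    have h2 : W.toBlocks₁₁ (default : m) default = 0 := hdiag _
    simp [dotProduct, mulVec, Hmat_apply, h2]
  set C : ℝ := (2 / Real.pi) ^ ((Fintype.card (m ⊕ n) : ℝ) / 2) *
    Real.exp (-(1/2) * (k - 2 * (w ⬝ᵥ 1) + 1 ⬝ᵥ D *ᵥ 1 + y ⬝ᵥ D⁻¹ *ᵥ y) + (z default + y ⬝ᵥ 1)) / √D.det
    with hC
  have hC0 : 0 ≤ C := by positivity
  have hpt : ∀ x : ℝ, nuDens W η (Sum.elim (fun _ => x) c) = ENNReal.ofReal C * 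
      Set.indicator (Set.Ioi (0:ℝ))
      (fun s => ENNReal.ofReal (Real.exp (-(s + a^2/s)/2) / √s)) (2 * x - k) := by
    intro x
    set A := Hmat W.toBlocks₁₁ (fun _ : m => x) with hA
    have hiff := posDef_schur A B hDp
    rw [posDef_unique (A - B * D⁻¹ * Bᵀ), hSk, ← hH] at hiff
    by_cases hs : 0 < 2 * x - k
    swap
    · rw [Set.indicator_of_notMem (by simpa using hs), mul_zero, nuDens_eq, if_neg (fun h => hs (hiff.1 h))]
    have hSp : (A - B * D⁻¹ * Bᵀ).PosDef := by rw [posDef_unique, hSk]; exact hs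
    rw [Set.indicator_of_mem (by simpa using hs), nuDens_eq, if_pos (hiff.2 hs), ← ENNReal.ofReal_mul hC0]
    congr 1
    have hdet := det_schur A B hDp
    have hq := quad_inv_schur A B hDp hSp z y
    have ho := quad_one_sum A B D
    have hr : (z - B *ᵥ (D⁻¹ *ᵥ y)) default = a := by
      rw [Pi.sub_apply, hBv, ha]; ring
    rw [quad_inv_unique (A - B * D⁻¹ * Bᵀ) (by rw [hSk]; exact hs), hSk, hr] at hq
    rw [det_unique (A - B * D⁻¹ * Bᵀ), hSk] at hdet
    rw [hA1, hB1] at ho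
    rw [← hH] at hdet hq ho
    rw [← hη] at hq
    rw [hdet, hq, ho, hηo, Real.sqrt_mul hDp.det_pos.le, hC]
    set s := 2 * x - k with hsd
    rw [show 2 * x = s + k by rw [hsd]; ring]
    rw [show -(1/2) * (s + k + 2 * -(w ⬝ᵥ 1) + 1 ⬝ᵥ D *ᵥ 1 + (y ⬝ᵥ D⁻¹ *ᵥ y + a^2/s)) + (z default + y ⬝ᵥ 1)
      = (-(1/2) * (k - 2 * (w ⬝ᵥ 1) + 1 ⬝ᵥ D *ᵥ 1 + y ⬝ᵥ D⁻¹ *ᵥ y) + (z default + y ⬝ᵥ 1)) + 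
        (-(s + a^2/s)/2) by ring, Real.exp_add]
    have := Real.sqrt_pos.2 hDp.det_pos
    have := Real.sqrt_pos.2 hs
    field_simp
  rw [lintegral_congr hpt, lintegral_const_mul' _ _ ENNReal.ofReal_ne_top, scalar_shift ha0,
    ← ENNReal.ofReal_mul hC0, nuDens_eq, if_pos hDp]
  congr 1
  rw [hC, rpow_card_add, ← hD]
  have hc1 : (2 / Real.pi) ^ ((Fintype.card m : ℝ) / 2) * √(Real.pi / 2) = 1 := by
    rw [Fintype.card_unique, Nat.cast_one, ← Real.sqrt_eq_rpow, ← Real.sqrt_mul (by positivity)]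
    have : (2 / Real.pi) * (Real.pi / 2) = 1 := by field_simp
    rw [this, Real.sqrt_one]
  have hDt : D⁻¹ᵀ = D⁻¹ := by
    have := hDp.inv.isHermitian
    rwa [IsHermitian, conjTranspose_eq_transpose_of_trivial] at this
  have hsy : y ⬝ᵥ D⁻¹ *ᵥ w = w ⬝ᵥ D⁻¹ *ᵥ y := by
    rw [dotProduct_mulVec, ← mulVec_transpose, hDt, dotProduct_comm]
  have hex : -(1/2) * (1 ⬝ᵥ D *ᵥ 1 + (y + w) ⬝ᵥ D⁻¹ *ᵥ (y + w)) + (y + w) ⬝ᵥ 1 = 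
      (-(1/2) * (k - 2 * (w ⬝ᵥ 1) + 1 ⬝ᵥ D *ᵥ 1 + y ⬝ᵥ D⁻¹ *ᵥ y) + (z default + y ⬝ᵥ 1)) + -a := by
    rw [mulVec_add, dotProduct_add, add_dotProduct, add_dotProduct, add_dotProduct, hsy, ← hk, ha]
    ring
  rw [hex, Real.exp_add _ (-a)]
  rw [show ∀ p q E F d t : ℝ, p * q * E / d * (t * F) = (p * t) * (q * (E * F) / d) from
    fun p q E F d t => by ring, hc1, one_mul]

end dens
section meas
open ProbabilityTheory

lemma map_withDensity_equiv {α β : Type*} [MeasurableSpace α] [MeasurableSpace β] {μ : Measure α}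
    {ν : Measure β} (φ : α ≃ᵐ β) (h : MeasurePreserving φ μ ν) (f : α → ENNReal) :
    (μ.withDensity f).map φ = ν.withDensity (f ∘ φ.symm) := by
  ext s hs
  rw [φ.map_apply, withDensity_apply _ (φ.measurable hs), withDensity_apply _ hs,
    ← h.setLIntegral_comp_preimage_emb φ.measurableEmbedding]
  simp

lemma lintegral_unique {m : Type*} [Unique m] [inst : Fintype m] (F : (m → ℝ) → ENNReal) :
    ∫⁻ b, F b = ∫⁻ x : ℝ, F (fun _ => x) := by
  obtain rfl : inst = Unique.fintype := Subsingleton.elim _ _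
  have hu := (volume_preserving_funUnique m ℝ).symm
  exact (hu.lintegral_comp_emb (MeasurableEquiv.measurableEmbedding _) F).symm

variable {V : Type*} [Fintype V] [DecidableEq V]

lemma nuDens_split (p : V → Prop) [DecidablePred p] (W : Matrix V V ℝ) (η : V → ℝ)
    (b : {x // p x} → ℝ) (c : {x // ¬ p x} → ℝ) :
    nuDens W η ((MeasurableEquiv.piEquivPiSubtypeProd (fun _ : V => ℝ) p).symm (b, c)) =
    nuDens (W.submatrix (Equiv.sumCompl p) (Equiv.sumCompl p)) (η ∘ Equiv.sumCompl p) (Sum.elim b c) := by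
  rw [← nuDens_reindex (Equiv.sumCompl p)]
  congr 1
  ext (i | i)
  · simp [MeasurableEquiv.piEquivPiSubtypeProd, Equiv.piEquivPiSubtypeProd, i.2]
  · simp [MeasurableEquiv.piEquivPiSubtypeProd, Equiv.piEquivPiSubtypeProd, i.2]

lemma nuMeas_map_prod (p : V → Prop) [DecidablePred p] (W : Matrix V V ℝ) (hW : W.IsSymm) (η : V → ℝ)
    (h0 : ∀ i j, p i → ¬ p j → W i j = 0) :
    (nuMeas W η).map (MeasurableEquiv.piEquivPiSubtypeProd (fun _ : V => ℝ) p) =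
    (nuMeas (W.submatrix (Subtype.val : {x // p x} → V) Subtype.val) (η ∘ Subtype.val)).prod 
    (nuMeas (W.submatrix (Subtype.val : {x // ¬ p x} → V) Subtype.val) (η ∘ Subtype.val)) := by
  unfold nuMeas
  rw [map_withDensity_equiv _ (volume_preserving_piEquivPiSubtypeProd (fun _ : V => ℝ) p),
    prod_withDensity (nuDens_measurable _ (hW.submatrix _) _) (nuDens_measurable _ (hW.submatrix _) _)]
  congr 1
  ext ⟨b, c⟩
  rw [Function.comp_apply, nuDens_split, nuDens_prod (hW.submatrix _)]
  · rfl
  · ext i j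
    exact h0 _ _ i.2 j.2

lemma nuMeas_map_marg' (p : V → Prop) [DecidablePred p] [Unique {x // p x}] (W : Matrix V V ℝ) (hW : W.IsSymm) (hnn : ∀ i j, 0 ≤ W i j)
    (hdiag : ∀ i, W i i = 0) (η : V → ℝ) (hη : ∀ i, 0 ≤ η i) :
    (nuMeas W η).map (fun β (i : {x // ¬ p x}) => β i.1) =
    nuMeas (W.submatrix (Subtype.val : {x // ¬ p x} → V) Subtype.val) (fun j => η j.1 + W (default : {x // p x}).1 j.1) := by
  have hcomp : (fun (β : V → ℝ) (i : {x // ¬ p x}) => β i.1) = 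
      Prod.snd ∘ (MeasurableEquiv.piEquivPiSubtypeProd (fun _ : V => ℝ) p) := rfl
  rw [hcomp, ← Measure.map_map measurable_snd (MeasurableEquiv.measurable _)]
  unfold nuMeas
  set φ := MeasurableEquiv.piEquivPiSubtypeProd (fun _ : V => ℝ) p with hφ
  rw [map_withDensity_equiv _ (volume_preserving_piEquivPiSubtypeProd (fun _ : V => ℝ) p)]
  have hm : Measurable (nuDens W η ∘ φ.symm) := (nuDens_measurable W hW η).comp φ.symm.measurable
  ext s hs
  rw [Measure.map_apply measurable_snd hs, withDensity_apply _ (measurable_snd hs),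
    withDensity_apply _ hs, ← Set.univ_prod, Measure.volume_eq_prod, ← Measure.prod_restrict,
    Measure.restrict_univ, lintegral_prod_symm' _ hm]
  refine lintegral_congr fun c => ?_
  refine (lintegral_unique (m := {x // p x}) fun b => nuDens W η (φ.symm (b, c))).trans ?_
  have := nuDens_marg (m := {x // p x}) (hW.submatrix (Equiv.sumCompl p)) 
    (fun i j => hnn _ _) (fun i => hdiag _) (η ∘ (Equiv.sumCompl p)) (fun i => hη _) c
  refine Eq.trans (lintegral_congr fun x => ?_) this
  exact nuDens_split _ _ _ _ _

lemma nuMeas_map_marg (v : V) (W : Matrix V V ℝ) (hW : W.IsSymm) (hnn : ∀ i j, 0 ≤ W i j)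
    (hdiag : ∀ i, W i i = 0) (η : V → ℝ) (hη : ∀ i, 0 ≤ η i) :
    (nuMeas W η).map (fun β (i : {x // ¬ x = v}) => β i.1) =
    nuMeas (W.submatrix (Subtype.val : {x // ¬ x = v} → V) Subtype.val) (fun j => η j.1 + W v j.1) :=
  nuMeas_map_marg' (fun x => x = v) W hW hnn hdiag η hη

lemma indep_of_map {Ω Ω' α β : Type*} [MeasurableSpace Ω] [MeasurableSpace Ω'] [MeasurableSpace α]
    [MeasurableSpace β] {μ : Measure Ω} {r : Ω → Ω'} (hr : Measurable r) {f : Ω' → α} {g : Ω' → β}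
    (hf : Measurable f) (hg : Measurable g) (h : IndepFun f g (μ.map r)) :
    IndepFun (f ∘ r) (g ∘ r) μ := by
  rw [indepFun_iff_measure_inter_preimage_eq_mul] at h ⊢
  intro s t hs ht
  have := h s t hs ht
  rwa [Measure.map_apply hr ((hf hs).inter (hg ht)), Measure.map_apply hr (hf hs),
    Measure.map_apply hr (hg ht)] at this

lemma nuMeas_prob (N : ℕ) : ∀ (V : Type u) [Fintype V] [DecidableEq V] (_ : Fintype.card V = N)
    (W : Matrix V V ℝ) (_ : W.IsSymm) (_ : ∀ i j, 0 ≤ W i j)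
    (_ : ∀ i, W i i = 0) (η : V → ℝ) (_ : ∀ i, 0 ≤ η i), IsProbabilityMeasure (nuMeas W η) := by
  induction N with
  | zero =>
    intro V _ _ hcard W hW hnn hdiag η hη
    have : IsEmpty V := Fintype.card_eq_zero_iff.1 hcard
    constructor
    unfold nuMeas
    rw [withDensity_apply _ MeasurableSet.univ, Measure.restrict_univ]
    have h1 : ∀ β, nuDens W η β = 1 := by
      intro β
      rw [nuDens_eq, if_pos (by rw [posDef_iff_dotProduct_mulVec]; exact ⟨by ext i; exact isEmptyElim i, fun x hx => absurd (Subsingleton.elim x 0) hx⟩)]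
      simp [dotProduct]
    rw [lintegral_congr h1, lintegral_one, volume_pi, Measure.pi_of_empty]
    simp
  | succ N ih =>
    intro V _ _ hcard W hW hnn hdiag η hη
    have hne : Nonempty V := Fintype.card_pos_iff.1 (by omega)
    obtain ⟨v⟩ := hne
    have hmap := nuMeas_map_marg v W hW hnn hdiag η hη
    have := ih {x // ¬ x = v} (by rw [Fintype.card_subtype_compl]; simp [hcard]) 
      (W.submatrix Subtype.val Subtype.val) (hW.submatrix _) (fun i j => hnn _ _) (fun i => hdiag _)
      (fun j => η j.1 + W v j.1) (fun j => add_nonneg (hη _) (hnn _ _))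
    rw [← hmap] at this
    constructor
    have h1 := this.measure_univ
    rwa [Measure.map_apply (by fun_prop) MeasurableSet.univ, Set.preimage_univ] at h1

lemma nuMeas_indep {ι κ : Type*} (N : ℕ) : ∀ (V : Type u) [Fintype V] [DecidableEq V] (_ : Fintype.card V = N)
    (W : Matrix V V ℝ) (_ : W.IsSymm) (_ : ∀ i j, 0 ≤ W i j)
    (_ : ∀ i, W i i = 0) (η : V → ℝ) (_ : ∀ i, 0 ≤ η i) (f : ι → V) (g : κ → V)
    (_ : ∀ i j, f i ≠ g j ∧ W (f i) (g j) = 0), 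
    IndepFun (fun (β : V → ℝ) i => β (f i)) (fun (β : V → ℝ) j => β (g j)) (nuMeas W η) := by
  classical
  induction N using Nat.strong_induction_on with
  | _ N ih =>
    intro V _ _ hcard W hW hnn hdiag η hη f g hfg
    by_cases hv : ∃ v, v ∉ Set.range f ∧ v ∉ Set.range g
    · obtain ⟨v, hvf, hvg⟩ := hv
      have hmap := nuMeas_map_marg v W hW hnn hdiag η hη
      have hpos : 0 < Fintype.card V := Fintype.card_pos_iff.2 ⟨v⟩
      have hc : Fintype.card {x // ¬ x = v} = N - 1 := by
        rw [Fintype.card_subtype_compl]; simp [hcard]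
      have := ih (N - 1) (by omega) {x // ¬ x = v} hc
        (W.submatrix Subtype.val Subtype.val) (hW.submatrix _) (fun i j => hnn _ _) (fun i => hdiag _)
        (fun j => η j.1 + W v j.1) (fun j => add_nonneg (hη _) (hnn _ _))
        (fun i => ⟨f i, fun h => hvf ⟨i, h⟩⟩) (fun i => ⟨g i, fun h => hvg ⟨i, h⟩⟩)
        (fun i j => ⟨fun h => (hfg i j).1 (congrArg Subtype.val h), (hfg i j).2⟩)
      rw [← hmap] at this
      exact indep_of_map (by fun_prop) (by fun_prop) (by fun_prop) this
    · push Not at hv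
      let p : V → Prop := fun x => x ∈ Set.range f
      have hgp : ∀ j, ¬ p (g j) := by
        rintro j ⟨i, hi⟩; exact (hfg i j).1 hi
      have hmap := nuMeas_map_prod p W hW η (by
        rintro i j ⟨a, rfl⟩ hj
        obtain ⟨b, rfl⟩ := hv j hj
        exact (hfg a b).2)
      have h1 := nuMeas_prob _ {x // p x} rfl (W.submatrix Subtype.val Subtype.val) (hW.submatrix _)
        (fun i j => hnn _ _) (fun i => hdiag _) (η ∘ Subtype.val) (fun i => hη _)
      have h2 := nuMeas_prob _ {x // ¬ p x} rfl (W.submatrix Subtype.val Subtype.val) (hW.submatrix _)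
        (fun i j => hnn _ _) (fun i => hdiag _) (η ∘ Subtype.val) (fun i => hη _)
      have h3 := indepFun_prod (μ := (nuMeas (W.submatrix (Subtype.val : {x // p x} → V) Subtype.val) (η ∘ Subtype.val)))
        (ν := (nuMeas (W.submatrix (Subtype.val : {x // ¬ p x} → V) Subtype.val) (η ∘ Subtype.val)))
        (X := fun (b : {x // p x} → ℝ) (i : ι) => b ⟨f i, ⟨i, rfl⟩⟩)
        (Y := fun (b : {x // ¬ p x} → ℝ) (j : κ) => b ⟨g j, hgp j⟩) (by fun_prop) (by fun_prop)
      rw [← hmap] at h3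
      exact indep_of_map (MeasurableEquiv.measurable _) (by fun_prop) (by fun_prop) h3

end meas


theorem stmt2 {V : Type*} [Fintype V] [DecidableEq V] [Nonempty V]
    (W : Matrix V V ℝ) (hsymm : W.IsSymm) (hnn : ∀ i j, 0 ≤ W i j)
    (hdiag : ∀ i, W i i = 0) (hconn : (graphOf W).Connected)
    (V₁ V₂ : Set V)
    (hdist : ∀ i ∈ V₁, ∀ j ∈ V₂,
      i ≠ j ∧ W i j = 0 ∧ ¬∃ k : V, 0 < W i k ∧ 0 < W k j) :
    ProbabilityTheory.IndepFun
      (fun (β : V → ℝ) (i : V₁) => β i.1)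
      (fun (β : V → ℝ) (j : V₂) => β j.1)
      (nuMeas W 0) := by
  exact nuMeas_indep _ V rfl W hsymm hnn hdiag 0 (fun _ => le_rfl) (fun i : V₁ => i.1)
    (fun j : V₂ => j.1)
    (fun i j => ⟨(hdist i.1 i.2 j.1 j.2).1, (hdist i.1 i.2 j.1 j.2).2.1⟩)

end
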